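/- arXiv:2001.01914 — 3 statements merged into one kernel-verified Lean document; each statement's English description precedes it below -/
import Mathlib

section
/- Let n ≥ 4 be an even natural number, k ≥ 1, and let Σ be a type containing two distinct symbols a ≠ b. Let Q ⊆ Fin n × Fin k be a set of queried positions whose complement contains some position (z', j') with z' < n/2 and some position (z'', j'') with z'' ≥ n/2. Let A : (Fin n → Fin k → Σ) → (Fin k → Σ) be any map such that A x = A y whenever x and y agree on Q. Then there exists an input x : Fin n → Fin k → Σ that has a unique most frequent string u and A x ≠ u. (Hence any deterministic non-adaptive algorithm for the Most Frequently String Search problem that does not query at least one position in each half of the input errs on some input; this yields the Ω(nk) deterministic query lower bound.) -/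
/-- The number of occurrences of the string `w` in the input `x`. -/
noncomputable def occurrences {Alpha : Type*} {n k : ℕ} (x : Fin n → Fin k → Alpha)
    (w : Fin k → Alpha) : ℕ :=
  Set.ncard {i : Fin n | x i = w}

/-- If `x` equals `s` on `S` except at one index `z ∈ S`, and equals `t` off `S`, where `S` has at
least two elements and is no larger than its complement, then `t` is the unique most frequent
string of `x`. -/
theorem occurrences_lt_of_eq_off {Alpha : Type*} {n k : ℕ} {x : Fin n → Fin k → Alpha}
    {s t : Fin k → Alpha} {S : Finset (Fin n)} {z : Fin n}
    (hzS : z ∈ S) (hS : 2 ≤ S.card) (hcard : S.card ≤ Sᶜ.card)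
    (hs : ∀ i ∈ S, i ≠ z → x i = s) (ht : ∀ i ∉ S, x i = t) (hz : x z ≠ s)
    {v : Fin k → Alpha} (hv : v ≠ t) : occurrences x v < occurrences x t := by
  have hle : Sᶜ.card ≤ occurrences x t := by
    rw [← Set.ncard_coe_finset]
    exact Set.ncard_le_ncard (fun i hi => ht i (by simpa using hi)) (Set.toFinite _)
  have hmem : ∀ i, x i = v → i ∈ S := fun i hi => by
    by_contra h
    exact hv (hi.symm.trans (ht i h))
  refine lt_of_lt_of_le ?_ (hcard.trans hle)
  by_cases hvs : v = s
  · refine lt_of_le_of_lt ?_ (Finset.card_erase_lt_of_mem hzS)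
    rw [← Set.ncard_coe_finset]
    refine Set.ncard_le_ncard (fun i hi => ?_) (Set.toFinite _)
    have hi : x i = v := hi
    rw [Finset.mem_coe, Finset.mem_erase]
    refine ⟨?_, hmem i hi⟩
    rintro rfl
    exact hz (hi.trans hvs)
  · refine lt_of_le_of_lt (b := 1) ?_ hS
    rw [← Set.ncard_singleton z]
    refine Set.ncard_le_ncard (fun i hi => ?_) (Set.toFinite _)
    have hi : x i = v := hi
    by_contra h
    exact hvs (hi.symm.trans (hs i (hmem i hi) h))

/-- Overwriting one unqueried position does not change the input on the queried ones. -/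
theorem update_update_apply_of_notMem {Alpha : Type*} {n k : ℕ} {Q : Set (Fin n × Fin k)}
    {z : Fin n} {j : Fin k} (h : (z, j) ∉ Q) (x : Fin n → Fin k → Alpha) (c : Alpha)
    {p : Fin n × Fin k} (hp : p ∈ Q) :
    Function.update x z (Function.update (x z) j c) p.1 p.2 = x p.1 p.2 := by
  obtain ⟨i, l⟩ := p
  by_cases hi : i = z
  · subst hi
    have hl : l ≠ j := by
      rintro rfl
      exact h hp
    simp [hl]
  · simp [hi]

/-- Deterministic `Ω(nk)` lower bound for the Most Frequently String Search problem:
any deterministic non-adaptive algorithm that leaves unqueried a position in the first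
half and a position in the second half of the input errs on some input. -/
theorem most_frequent_string_lower_bound {Alpha : Type*} {n k : ℕ}
    (hn : 4 ≤ n) (hne : Even n) (hk : 1 ≤ k) (a b : Alpha) (hab : a ≠ b)
    (Q : Set (Fin n × Fin k))
    (z' : Fin n) (j' : Fin k) (hz' : (z' : ℕ) < n / 2) (hQ' : (z', j') ∉ Q)
    (z'' : Fin n) (j'' : Fin k) (hz'' : n / 2 ≤ (z'' : ℕ)) (hQ'' : (z'', j'') ∉ Q)
    (A : (Fin n → Fin k → Alpha) → (Fin k → Alpha))
    (hA : ∀ x y : Fin n → Fin k → Alpha,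
      (∀ p ∈ Q, x p.1 p.2 = y p.1 p.2) → A x = A y) :
    ∃ (x : Fin n → Fin k → Alpha) (u : Fin k → Alpha),
      (∀ v : Fin k → Alpha, v ≠ u → occurrences x v < occurrences x u) ∧ A x ≠ u := by
  classical
  let S : Finset (Fin n) := Finset.univ.filter fun i => (i : ℕ) < n / 2
  have hScard : S.card = n / 2 := by
    simp only [S, Fin.card_filter_val_lt]
    omega
  have hSc : Sᶜ.card = n / 2 := by
    rw [Finset.card_compl, Fintype.card_fin, hScard]
    obtain ⟨m, rfl⟩ := hne
    omega
  have hzS : z' ∈ S := by simpa [S] using hz'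
  have hzSc : z'' ∈ Sᶜ := by simpa [S] using hz''
  have hzS' : z'' ∉ S := by simpa using hzSc
  let w : Fin n → Fin k → Alpha := fun i _ => if i ∈ S then a else b
  let x := Function.update w z' (Function.update (w z') j' b)
  let y := Function.update w z'' (Function.update (w z'') j'' a)
  have hAxy : A x = A y := hA x y fun p hp =>
    (update_update_apply_of_notMem hQ' w b hp).trans
      (update_update_apply_of_notMem hQ'' w a hp).symm
  have hx : ∀ v : Fin k → Alpha, v ≠ (fun _ => b) →
      occurrences x v < occurrences x (fun _ => b) := fun v hv => by
    refine occurrences_lt_of_eq_off (s := fun _ => a) hzS (by omega) (by omega) ?_ ?_ ?_ hv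
    · intro i hi hiz
      simp [x, w, hiz, hi]
    · intro i hi
      have hiz : i ≠ z' := fun h => hi (h ▸ hzS)
      simp [x, w, hiz, hi]
    · intro h
      exact hab.symm (by simpa [x] using congrFun h j')
  have hy : ∀ v : Fin k → Alpha, v ≠ (fun _ => a) →
      occurrences y v < occurrences y (fun _ => a) := fun v hv => by
    refine occurrences_lt_of_eq_off (s := fun _ => b) hzSc (by omega)
      (by rw [compl_compl]; omega) ?_ ?_ ?_ hv
    · intro i hi hiz
      have hi : i ∉ S := by simpa using hi
      simp [y, w, hiz, hi]
    · intro i hi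
      have hi : i ∈ S := by simpa using hi
      have hiz : i ≠ z'' := fun h => hzS' (h ▸ hi)
      simp [y, w, hiz, hi]
    · intro h
      exact hab (by simpa [y] using congrFun h j'')
  by_cases h : A x = fun _ => b
  · refine ⟨y, _, hy, fun h' => hab ?_⟩
    exact congrFun (h'.symm.trans (hAxy.symm.trans h)) j'
  · exact ⟨x, _, hx, h⟩
end

section
/- Let Σ be a linearly ordered alphabet with a < b, let n ≥ 2 and k ≥ 1, and let Q ⊆ Fin n × Fin k be a set of queried positions whose complement contains two positions (i₀, j₀) and (i₁, j₁) with i₀ ≠ i₁. Let A be any map sending each input x : Fin n → Fin k → Σ to a bijection A x : Fin n → Fin n, such that A x = A y whenever x and y agree on Q. Then there exists an input x : Fin n → Fin k → Σ such that A x is not a valid sorted order of x, i.e. there exists l < n − 1 with x ((A x) (l+1)) strictly lexicographically less than x ((A x) l). (Hence any deterministic non-adaptive algorithm for sorting n strings of length k that leaves positions in two distinct rows unqueried errs on some input; this yields the Ω(nk) deterministic query lower bound for string sorting.) -/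
/-- The input all of whose entries are `a`, except for a single `b` at position `(i, j)`. -/
def singleEntryInput {Alpha : Type*} {n k : ℕ} (a b : Alpha) (i : Fin n) (j : Fin k) :
    Fin n → Fin k → Alpha :=
  Function.update (fun _ _ => a) i (Function.update (fun _ => a) j b)

theorem singleEntryInput_eq_of_ne {Alpha : Type*} {n k : ℕ} (a b : Alpha) {i : Fin n} {j : Fin k}
    {p : Fin n × Fin k} (hp : p ≠ (i, j)) : singleEntryInput a b i j p.1 p.2 = a := by
  obtain ⟨i', j'⟩ := p
  by_cases h : i' = i
  · subst h
    have hj : j' ≠ j := fun h => hp (by rw [h])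
    simp [singleEntryInput, hj]
  · simp [singleEntryInput, h]

/-- Every other row of `singleEntryInput a b i j` is strictly below row `i` when `a < b`. -/
theorem singleEntryInput_lex_lt {Alpha : Type*} [LinearOrder Alpha] {n k : ℕ} {a b : Alpha}
    (hab : a < b) {i i' : Fin n} (j : Fin k) (h : i' ≠ i) :
    Pi.Lex (· < ·) (· < ·) (singleEntryInput a b i j i') (singleEntryInput a b i j i) := by
  refine ⟨j, fun j' hj' => ?_, ?_⟩
  · have hj : j' ≠ j := ne_of_lt hj'
    simp [singleEntryInput, h, hj]
  · simpa [singleEntryInput, h] using hab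

/-- A permutation sorting `singleEntryInput a b i j` puts row `i` last. -/
theorem exists_lex_lt_of_symm_apply_succ_lt {Alpha : Type*} [LinearOrder Alpha] {n k : ℕ}
    {a b : Alpha} (hab : a < b) (i : Fin n) (j : Fin k) (σ : Equiv.Perm (Fin n))
    (h : (σ.symm i : ℕ) + 1 < n) :
    ∃ (l : ℕ) (h : l + 1 < n),
      Pi.Lex (· < ·) (· < ·) (singleEntryInput a b i j (σ ⟨l + 1, h⟩))
        (singleEntryInput a b i j (σ ⟨l, Nat.lt_of_succ_lt h⟩)) := by
  refine ⟨σ.symm i, h, ?_⟩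
  rw [Fin.eta, Equiv.apply_symm_apply]
  refine singleEntryInput_lex_lt hab j fun he => ?_
  have := congrArg Fin.val (σ.eq_symm_apply.2 he)
  simp at this

/-- Deterministic `Ω(nk)` lower bound for sorting strings: any deterministic
non-adaptive algorithm whose output permutation depends only on the queried
positions `Q`, with unqueried positions in two distinct rows, fails to sort some
input in lexicographic order. -/
theorem string_sorting_lower_bound {Alpha : Type*} [LinearOrder Alpha] {n k : ℕ}
    (hn : 2 ≤ n) (hk : 1 ≤ k) (a b : Alpha) (hab : a < b)
    (Q : Set (Fin n × Fin k))
    (i₀ i₁ : Fin n) (j₀ j₁ : Fin k) (hi : i₀ ≠ i₁)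
    (hQ₀ : (i₀, j₀) ∉ Q) (hQ₁ : (i₁, j₁) ∉ Q)
    (A : (Fin n → Fin k → Alpha) → Equiv.Perm (Fin n))
    (hA : ∀ x y : Fin n → Fin k → Alpha,
      (∀ p ∈ Q, x p.1 p.2 = y p.1 p.2) → A x = A y) :
    ∃ (x : Fin n → Fin k → Alpha) (l : ℕ) (h : l + 1 < n),
      Pi.Lex (· < ·) (· < ·)
        (x ((A x) ⟨l + 1, h⟩)) (x ((A x) ⟨l, Nat.lt_of_succ_lt h⟩)) := by
  have hagree : A (singleEntryInput a b i₀ j₀) = A (singleEntryInput a b i₁ j₁) :=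
    hA _ _ fun p hp =>
      (singleEntryInput_eq_of_ne a b fun h => hQ₀ (h ▸ hp)).trans
        (singleEntryInput_eq_of_ne a b fun h => hQ₁ (h ▸ hp)).symm
  by_cases h₀ : ((A (singleEntryInput a b i₀ j₀)).symm i₀ : ℕ) + 1 < n
  · exact ⟨_, exists_lex_lt_of_symm_apply_succ_lt hab i₀ j₀ _ h₀⟩
  by_cases h₁ : ((A (singleEntryInput a b i₁ j₁)).symm i₁ : ℕ) + 1 < n
  · exact ⟨_, exists_lex_lt_of_symm_apply_succ_lt hab i₁ j₁ _ h₁⟩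
  rw [hagree] at h₀
  refine absurd ((A (singleEntryInput a b i₁ j₁)).symm.injective (Fin.ext ?_)) hi
  omega
end

section
/- Let Σ contain two distinct symbols a ≠ b, let n ≥ 1 and k ≥ 1, and let s₀ : Fin n → (Fin k → Σ) be the sequence in which every string is the constant-a string. Let Q ⊆ Fin k with Q ≠ Fin k (at least one position of the requested string is unqueried), and let A : (Fin k → Σ) → Bool be any map such that A t = A t' whenever t j = t' j for every j ∈ Q. Then there exists a string t : Fin k → Σ such that A t is not the correct answer to the membership query, i.e. A t = true does not hold iff (∃ i : Fin n, s₀ i = t). (Hence any deterministic non-adaptive algorithm answering a membership request in the Intersection of Two String Sequences problem must query all k positions of the requested string; this underlies the Ω((n+m)k) deterministic query lower bound.) -/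
/-- Deterministic lower bound for a membership request in the Intersection of Two
String Sequences problem: if the first sequence consists of `n` copies of the
constant-`a` string and the algorithm's answer to a request `t` depends only on the
symbols of `t` at a proper subset `Q` of the positions, then the algorithm answers
some request incorrectly. -/
theorem intersection_membership_lower_bound {Alpha : Type*} (a b : Alpha) (hab : a ≠ b)
    {n k : ℕ} (hn : 1 ≤ n) (hk : 1 ≤ k)
    (s₀ : Fin n → Fin k → Alpha) (hs₀ : ∀ i : Fin n, s₀ i = fun _ => a)
    (Q : Set (Fin k)) (hQ : Q ≠ Set.univ)
    (A : (Fin k → Alpha) → Bool)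
    (hA : ∀ t t' : Fin k → Alpha, (∀ j ∈ Q, t j = t' j) → A t = A t') :
    ∃ t : Fin k → Alpha, ¬ (A t = true ↔ ∃ i : Fin n, s₀ i = t) := by
  classical
  by_contra! h
  obtain ⟨p, hp⟩ := (Set.ne_univ_iff_exists_notMem Q).mp hQ
  have hconst : A (fun _ => a) = true := (h _).mpr ⟨⟨0, hn⟩, hs₀ _⟩
  have hagree : A (Function.update (fun _ => a) p b) = A (fun _ => a) :=
    hA _ _ fun j hj => Function.update_of_ne (ne_of_mem_of_not_mem hj hp) _ _
  obtain ⟨i, hi⟩ := (h _).mp (hagree.trans hconst)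
  rw [hs₀ i] at hi
  exact hab (by simpa using congrFun hi p)
end
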